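/- arXiv:1902.00219 — 6 statements merged into one kernel-verified Lean document; each statement's English description precedes it below -/
import Mathlib

section
/- Let f, g : ℝ → ℝ and suppose the real line can be partitioned into d nonempty intervals such that on each interval both f and g are monotone (each one either nondecreasing or nonincreasing on that interval). Let z_1, …, z_m be real numbers such that the values f(z_1), …, f(z_m) are pairwise distinct, and let σ be a permutation of {1,…,m} with f(z_{σ(1)}) < f(z_{σ(2)}) < … < f(z_{σ(m)}). Then the sequence (g(z_{σ(1)}), …, g(z_{σ(m)})) can be partitioned into at most d monotone subsequences, i.e., D(g(z_{σ(1)}), …, g(z_{σ(m)})) ≤ d. -/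
/-- If `f ∘ u` is strictly monotone on `s` and `f` is monotone on a set into which `u` maps `s`, then
`u` is monotone on `s`. -/
theorem MonotoneOn.monotoneOn_of_strictMonoOn_comp {ι α β : Type*} [PartialOrder ι] [LinearOrder α]
    [Preorder β] {f : α → β} {u : ι → α} {s : Set ι} {t : Set α} (hf : MonotoneOn f t)
    (hu : Set.MapsTo u s t) (hfu : StrictMonoOn (fun i => f (u i)) s) : MonotoneOn u s := by
  intro i hi j hj hij
  rcases hij.eq_or_lt with rfl | hlt
  · exact le_rfl
  · by_contra! h
    exact (hfu hi hj hlt).not_ge (hf (hu hj) (hu hi) h.le)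

/-- If `ℝ` is partitioned into `d` nonempty intervals on each of which
both `f` and `g` are monotone, and `z₁,…,z_m` are reals with pairwise distinct `f`-values,
sorted by `f`-value via a permutation `σ`, then the sequence `g(z_{σ(1)}),…,g(z_{σ(m)})`
can be partitioned into at most `d` monotone subsequences. -/
theorem stmt0 (f g : ℝ → ℝ) (d : ℕ) (I : Fin d → Set ℝ)
    (hne : ∀ t, (I t).Nonempty) (hconn : ∀ t, (I t).OrdConnected)
    (hdisj : Pairwise (Function.onFun Disjoint I)) (hcover : (⋃ t, I t) = Set.univ)
    (hf : ∀ t, MonotoneOn f (I t) ∨ AntitoneOn f (I t))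
    (hg : ∀ t, MonotoneOn g (I t) ∨ AntitoneOn g (I t))
    (m : ℕ) (z : Fin m → ℝ) (hinj : Function.Injective (f ∘ z))
    (σ : Equiv.Perm (Fin m)) (hσ : StrictMono fun i => f (z (σ i))) :
    ∃ c : Fin m → Fin d, ∀ t : Fin d,
      MonotoneOn (fun i => g (z (σ i))) {i | c i = t} ∨
      AntitoneOn (fun i => g (z (σ i))) {i | c i = t} := by
  have hmem : ∀ i, ∃ t, z (σ i) ∈ I t := fun i =>
    Set.mem_iUnion.1 (hcover.symm ▸ Set.mem_univ (z (σ i)))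
  choose c hc using hmem
  refine ⟨c, fun t => ?_⟩
  have hmaps : Set.MapsTo (fun i => z (σ i)) {i | c i = t} (I t) := by
    rintro i rfl
    exact hc i
  have hz : MonotoneOn (fun i => z (σ i)) {i | c i = t} ∨
      AntitoneOn (fun i => z (σ i)) {i | c i = t} := by
    refine (hf t).imp (fun h => ?_) (fun h => ?_)
    · exact h.monotoneOn_of_strictMonoOn_comp hmaps (hσ.strictMonoOn _)
    · exact (h.dual_left.monotoneOn_of_strictMonoOn_comp
        (u := fun i => OrderDual.toDual (z (σ i))) hmaps (hσ.strictMonoOn _))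
  rcases hz with hz | hz <;> rcases hg t with h | h
  · exact .inl (h.comp hz hmaps)
  · exact .inr fun _ hi _ hj hij => h (hmaps hi) (hmaps hj) (hz hi hj hij)
  · exact .inr fun _ hi _ hj hij => h (hmaps hj) (hmaps hi) (hz hi hj hij)
  · exact .inl (h.comp hz hmaps)
end

section
/- Let μ be a natural number and let f, g : ℝ → ℝ be such that the real line can be partitioned into at most μ + 1 nonempty intervals on each of which f is monotone, and also into at most μ + 1 nonempty intervals on each of which g is monotone. Let z_1, …, z_m be real numbers with f(z_1), …, f(z_m) pairwise distinct, and let σ be a permutation of {1,…,m} with f(z_{σ(1)}) < … < f(z_{σ(m)}). Then D(g(z_{σ(1)}), …, g(z_{σ(m)})) ≤ 2μ + 1. -/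
/-- A cover of `ℝ` by at most `μ + 1` disjoint intervals of monotonicity of `f` yields a monotone
labelling of the points with labels at most `μ` such that `f` is monotone or antitone on each label
class. -/
theorem exists_monotone_label {μ a : ℕ} {f : ℝ → ℝ} (ha : a ≤ μ + 1) {I : Fin a → Set ℝ}
    (hI : ∀ t, (I t).OrdConnected) (hdisj : Pairwise (Function.onFun Disjoint I))
    (hcover : (⋃ t, I t) = Set.univ)
    (hmono : ∀ t, MonotoneOn f (I t) ∨ AntitoneOn f (I t)) :
    ∃ p : ℝ → ℕ, Monotone p ∧ (∀ x, p x ≤ μ) ∧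
      ∀ k, MonotoneOn f {x | p x = k} ∨ AntitoneOn f {x | p x = k} := by
  classical
  let S : ℝ → Finset (Fin a) := fun x =>
    Finset.univ.filter fun t => x ∉ I t ∧ ∃ y ∈ I t, y ≤ x
  have mem_S : ∀ x t, t ∈ S x ↔ x ∉ I t ∧ ∃ y ∈ I t, y ≤ x := by simp [S]
  have hS : Monotone S := by
    intro x y hxy t ht
    rw [mem_S] at ht ⊢
    obtain ⟨hx, w, hw, hwx⟩ := ht
    exact ⟨fun hy => hx ((hI t).out hw hy ⟨hwx, hxy⟩), w, hw, hwx.trans hxy⟩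
  have exists_mem : ∀ x, ∃ t, x ∈ I t := fun x => by
    simpa using hcover.ge (Set.mem_univ x)
  have mem_of_le : ∀ x y t, x ≤ y → (S x).card = (S y).card → x ∈ I t → y ∈ I t := by
    intro x y t hxy hc hx
    by_contra hy
    have heq := Finset.eq_of_subset_of_card_le (hS hxy) hc.ge
    have : t ∈ S x := heq ▸ (mem_S y t).2 ⟨hy, x, hx, hxy⟩
    exact ((mem_S x t).1 this).1 hx
  have mem_of_card_eq : ∀ x y t, (S x).card = (S y).card → x ∈ I t → y ∈ I t := by
    intro x y t hc hx
    rcases le_total x y with hxy | hyx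
    · exact mem_of_le x y t hxy hc hx
    · obtain ⟨s, hs⟩ := exists_mem y
      have hst : s = t := by
        by_contra hne
        exact Set.disjoint_left.1 (hdisj hne) (mem_of_le y x s hyx hc.symm hs) hx
      exact hst ▸ hs
  refine ⟨fun x => (S x).card, fun x y hxy => Finset.card_le_card (hS hxy), fun x => ?_,
    fun k => ?_⟩
  · obtain ⟨t, ht⟩ := exists_mem x
    have : (S x).card < (Finset.univ : Finset (Fin a)).card :=
      Finset.card_lt_card ((Finset.ssubset_univ_iff).2 fun h =>
        ((mem_S x t).1 (h ▸ Finset.mem_univ t)).1 ht)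
    rw [Finset.card_univ, Fintype.card_fin] at this
    exact Nat.lt_succ_iff.1 (this.trans_le ha)
  · rcases Set.eq_empty_or_nonempty {x | (S x).card = k} with h | ⟨x, hx⟩
    · rw [h]
      exact Or.inl (by simp [MonotoneOn])
    · obtain ⟨t, ht⟩ := exists_mem x
      have hsub : {x | (S x).card = k} ⊆ I t := fun y hy =>
        mem_of_card_eq x y t (hx.trans hy.symm) ht
      exact (hmono t).imp (fun h => h.mono hsub) fun h => h.mono hsub

/-- If `f` and `g` are each monotone or antitone on `A`, then listing points of `A` by increasing
`f`-value makes their `g`-values monotone or antitone. -/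
theorem monotoneOn_or_antitoneOn_of_strictMono {ι : Type*} [LinearOrder ι] {f g : ℝ → ℝ}
    {A : Set ℝ} {w : ι → ℝ} {s : Set ι} (hw : StrictMono fun i => f (w i))
    (hs : Set.MapsTo w s A) (hf : MonotoneOn f A ∨ AntitoneOn f A)
    (hg : MonotoneOn g A ∨ AntitoneOn g A) :
    MonotoneOn (fun i => g (w i)) s ∨ AntitoneOn (fun i => g (w i)) s := by
  have hw' : MonotoneOn w s ∨ AntitoneOn w s := by
    refine hf.imp (fun hf i hi j hj hij => ?_) fun hf i hi j hj hij => ?_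
    · by_contra! h
      obtain rfl := hw.le_iff_le.1 (hf (hs hj) (hs hi) h.le) |>.antisymm hij
      exact h.false
    · by_contra! h
      obtain rfl := hw.le_iff_le.1 (hf (hs hi) (hs hj) h.le) |>.antisymm hij
      exact h.false
  rcases hw' with hw' | hw' <;> rcases hg with hg | hg
  · exact Or.inl (hg.comp hw' hs)
  · exact Or.inr (fun _ hi _ hj hij => hg (hs hi) (hs hj) (hw' hi hj hij))
  · exact Or.inr (fun _ hi _ hj hij => hg (hs hj) (hs hi) (hw' hi hj hij))
  · exact Or.inl (hg.comp hw' hs)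

/-- If `f` and `g` each admit a partition of `ℝ` into at most `μ + 1` nonempty
intervals of monotonicity (i.e. have at most `μ` extremal points), and `z₁,…,z_m` have pairwise
distinct `f`-values sorted by the permutation `σ`, then the sequence
`g(z_{σ(1)}),…,g(z_{σ(m)})` can be partitioned into at most `2μ + 1` monotone subsequences. -/
theorem stmt2 (μ : ℕ) (f g : ℝ → ℝ)
    (hf : ∃ a ≤ μ + 1, ∃ I : Fin a → Set ℝ,
      (∀ t, (I t).Nonempty) ∧ (∀ t, (I t).OrdConnected) ∧
      Pairwise (Function.onFun Disjoint I) ∧ (⋃ t, I t) = Set.univ ∧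
      ∀ t, MonotoneOn f (I t) ∨ AntitoneOn f (I t))
    (hg : ∃ b ≤ μ + 1, ∃ J : Fin b → Set ℝ,
      (∀ t, (J t).Nonempty) ∧ (∀ t, (J t).OrdConnected) ∧
      Pairwise (Function.onFun Disjoint J) ∧ (⋃ t, J t) = Set.univ ∧
      ∀ t, MonotoneOn g (J t) ∨ AntitoneOn g (J t))
    (m : ℕ) (z : Fin m → ℝ) (hinj : Function.Injective (f ∘ z))
    (σ : Equiv.Perm (Fin m)) (hσ : StrictMono fun i => f (z (σ i))) :
    ∃ c : Fin m → Fin (2 * μ + 1), ∀ t : Fin (2 * μ + 1),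
      MonotoneOn (fun i => g (z (σ i))) {i | c i = t} ∨
      AntitoneOn (fun i => g (z (σ i))) {i | c i = t} := by
  obtain ⟨a, ha, I, -, hI, hIdisj, hIcover, hIf⟩ := hf
  obtain ⟨b, hb, J, -, hJ, hJdisj, hJcover, hJg⟩ := hg
  obtain ⟨p, hp, hpμ, hpf⟩ := exists_monotone_label ha hI hIdisj hIcover hIf
  obtain ⟨q, hq, hqμ, hqg⟩ := exists_monotone_label hb hJ hJdisj hJcover hJg
  have label_eq : ∀ x y, p x + q x = p y + q y → p x = p y ∧ q x = q y := by
    intro x y h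
    rcases le_total x y with hxy | hxy <;>
    · have := hp hxy
      have := hq hxy
      omega
  refine ⟨fun i => ⟨p (z (σ i)) + q (z (σ i)), ?_⟩, fun t => ?_⟩
  · have := hpμ (z (σ i))
    have := hqμ (z (σ i))
    omega
  · by_cases ht : ∃ x, p x + q x = t
    · obtain ⟨x, hx⟩ := ht
      refine monotoneOn_or_antitoneOn_of_strictMono (f := f) (g := g)
        (A := {y | p y = p x} ∩ {y | q y = q x}) hσ (fun i hi => ?_)
        ((hpf (p x)).imp (fun h => h.mono Set.inter_subset_left)
          fun h => h.mono Set.inter_subset_left)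
        ((hqg (q x)).imp (fun h => h.mono Set.inter_subset_right)
          fun h => h.mono Set.inter_subset_right)
      exact label_eq _ _ ((Fin.ext_iff.1 hi).trans hx.symm)
    · exact Or.inl fun i hi => absurd ⟨_, Fin.ext_iff.1 hi⟩ ht
end

section
/- Let σ be a uniformly random permutation of {1,…,m}, let 1 ≤ d ≤ m, and set ℓ = ⌈m/d⌉. Then the probability that the sequence (σ(1), …, σ(m)) can be partitioned into at most d monotone subsequences, i.e. that D(σ(1),…,σ(m)) ≤ d, is at most 2·C(m,ℓ)/ℓ!, where C(m,ℓ) is the binomial coefficient. -/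
/-- A permutation of a well-ordered type that is strictly monotone is the identity. -/
theorem Equiv.Perm.eq_one_of_strictMono {α : Type*} [LinearOrder α] [WellFoundedLT α]
    (e : Equiv.Perm α) (he : StrictMono e) : e = 1 := by
  let f : α ≃o α := ⟨e, fun {a b} => he.le_iff_le⟩
  have h : f = OrderIso.refl α := Subsingleton.elim _ _
  ext x
  exact DFunLike.congr_fun h x

/-- If `g ∘ σ` and `g ∘ τ` are monotone on `S` and become equal after permuting the elements
of `S`, then the two permutations of `S` agree. -/
theorem perm_eq_of_monotoneOn_comp {α β : Type*} [LinearOrder α] [Finite α] [LinearOrder β]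
    {g : α → β} (hg : Function.Injective g) {S : Finset α} {σ τ : Equiv.Perm α}
    (hσ : MonotoneOn (g ∘ σ) S) (hτ : MonotoneOn (g ∘ τ) S) {p q : Equiv.Perm S}
    (h : σ * Equiv.Perm.ofSubtype p = τ * Equiv.Perm.ofSubtype q) : p = q := by
  have hσ' : StrictMonoOn (g ∘ σ) S := hσ.strictMonoOn_of_injOn (hg.comp σ.injective).injOn
  have hτ' : StrictMonoOn (g ∘ τ) S := hτ.strictMonoOn_of_injOn (hg.comp τ.injective).injOn
  have key (x : S) : σ x = τ ((q * p⁻¹) x) := by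
    simpa using Equiv.congr_fun h ((p⁻¹ x : S) : α)
  have hmono : StrictMono (q * p⁻¹) := fun x y hxy => by
    have hlt := hσ' x.2 y.2 hxy
    simp only [Function.comp_apply, key] at hlt
    exact (hτ'.lt_iff_lt (Subtype.prop _) (Subtype.prop _)).1 hlt
  exact (mul_inv_eq_one.1 (Equiv.Perm.eq_one_of_strictMono _ hmono)).symm

/-- At most a proportion `1 / (#S)!` of all permutations `σ` make `g ∘ σ` monotone on `S`. -/
theorem card_monotoneOn_comp_mul_factorial_le {α β : Type*} [LinearOrder α] [Fintype α]
    [LinearOrder β] {g : α → β} (hg : Function.Injective g) (S : Finset α)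
    [DecidablePred fun σ : Equiv.Perm α => MonotoneOn (g ∘ σ) S] :
    (Finset.univ.filter fun σ : Equiv.Perm α => MonotoneOn (g ∘ σ) S).card *
      S.card.factorial ≤ (Fintype.card α).factorial := by
  have hS : S.card.factorial = (Finset.univ : Finset (Equiv.Perm S)).card := by
    rw [Finset.card_univ, Fintype.card_perm, Fintype.card_coe]
  rw [hS, ← Finset.card_product, ← Fintype.card_perm, ← Finset.card_univ]
  refine Finset.card_le_card_of_injOn (fun x => x.1 * Equiv.Perm.ofSubtype x.2)
    (fun _ _ => Finset.mem_coe.2 (Finset.mem_univ _)) ?_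
  rintro ⟨σ, p⟩ hx ⟨τ, q⟩ hy h
  simp only [Finset.coe_product, Set.mem_prod, Finset.mem_coe, Finset.mem_filter,
    Finset.mem_univ, true_and, and_true] at hx hy
  dsimp only at h
  obtain rfl := perm_eq_of_monotoneOn_comp hg hx hy h
  rw [mul_right_cancel h]

/-- In a colouring of `m` points with `d` colours, some `⌈m / d⌉` points share a colour. -/
theorem exists_monochromatic_of_ceil {m d : ℕ} (h1 : 1 ≤ d) (h2 : d ≤ m) (c : Fin m → Fin d) :
    ∃ t, ∃ S : Finset (Fin m), S.card = ⌈(m : ℚ) / d⌉₊ ∧ ∀ i ∈ S, c i = t := by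
  have hd : (0 : ℚ) < d := by exact_mod_cast h1
  have hm : (0 : ℚ) < m := by exact_mod_cast h1.trans h2
  have hpos : 0 < ⌈(m : ℚ) / d⌉₊ := Nat.ceil_pos.2 (div_pos hm hd)
  have hlt : d * (⌈(m : ℚ) / d⌉₊ - 1) < m := by
    have h := Nat.lt_ceil.1 (Nat.sub_lt hpos one_pos)
    rw [lt_div_iff₀ hd] at h
    rw [mul_comm]
    exact_mod_cast h
  obtain ⟨t, ht⟩ := Fintype.exists_lt_card_fiber_of_mul_lt_card c
    (n := ⌈(m : ℚ) / d⌉₊ - 1) (by simpa using hlt)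
  obtain ⟨S, hS, hcard⟩ := Finset.exists_subset_card_eq (Nat.le_of_pred_lt ht)
  exact ⟨t, S, hcard, fun i hi => (Finset.mem_filter.1 (hS hi)).2⟩

open scoped Classical in
/-- For a uniformly random permutation `σ` of `{1,…,m}`, `1 ≤ d ≤ m` and
`ℓ = ⌈m/d⌉`, the probability that `(σ(1),…,σ(m))` can be partitioned into at most `d`
monotone subsequences is at most `2·C(m,ℓ)/ℓ!`. -/
theorem stmt7 (m d : ℕ) (h1 : 1 ≤ d) (h2 : d ≤ m) (ℓ : ℕ) (hℓ : ℓ = ⌈(m : ℚ) / d⌉₊) :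
    ((Finset.univ.filter fun σ : Equiv.Perm (Fin m) =>
        ∃ c : Fin m → Fin d, ∀ t : Fin d,
          MonotoneOn (fun i => σ i) {i | c i = t} ∨
          AntitoneOn (fun i => σ i) {i | c i = t}).card : ℝ) /
      (Nat.factorial m) ≤ 2 * (m.choose ℓ : ℝ) / (Nat.factorial ℓ) := by
  let M : Finset (Fin m) → Finset (Equiv.Perm (Fin m)) := fun S =>
    Finset.univ.filter fun σ => MonotoneOn (id ∘ σ) S
  let A : Finset (Fin m) → Finset (Equiv.Perm (Fin m)) := fun S =>
    Finset.univ.filter fun σ => MonotoneOn (OrderDual.toDual ∘ σ) S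
  have hsub : (Finset.univ.filter fun σ : Equiv.Perm (Fin m) =>
        ∃ c : Fin m → Fin d, ∀ t : Fin d,
          MonotoneOn (fun i => σ i) {i | c i = t} ∨
          AntitoneOn (fun i => σ i) {i | c i = t}) ⊆
      (Finset.univ.powersetCard ℓ).biUnion fun S => M S ∪ A S := by
    intro σ hσ
    obtain ⟨c, hc⟩ := (Finset.mem_filter.1 hσ).2
    obtain ⟨t, S, hS, hSt⟩ := exists_monochromatic_of_ceil h1 h2 c
    refine Finset.mem_biUnion.2
      ⟨S, Finset.mem_powersetCard.2 ⟨Finset.subset_univ _, hS.trans hℓ.symm⟩, ?_⟩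
    refine Finset.mem_union.2 ((hc t).imp (fun h => ?_) fun h => ?_)
    · exact Finset.mem_filter.2 ⟨Finset.mem_univ _, h.mono hSt⟩
    · exact Finset.mem_filter.2 ⟨Finset.mem_univ _, (h.mono hSt).dual_right⟩
  have hfac : (0 : ℝ) < (ℓ.factorial : ℝ) := by exact_mod_cast ℓ.factorial_pos
  have hcard (S) (hS : S ∈ Finset.univ.powersetCard ℓ) :
      (M S ∪ A S).card * ℓ.factorial ≤ 2 * m.factorial := by
    obtain rfl := (Finset.mem_powersetCard.1 hS).2
    have hM := card_monotoneOn_comp_mul_factorial_le Function.injective_id S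
    have hA := card_monotoneOn_comp_mul_factorial_le
      (OrderDual.toDual (α := Fin m)).injective S
    rw [Fintype.card_fin] at hM hA
    calc (M S ∪ A S).card * S.card.factorial
        ≤ ((M S).card + (A S).card) * S.card.factorial := by
          gcongr
          exact Finset.card_union_le _ _
      _ ≤ 2 * m.factorial := by
          rw [add_mul, two_mul]
          exact add_le_add hM hA
  rw [div_le_div_iff₀ (by exact_mod_cast m.factorial_pos) hfac]
  norm_cast
  calc _ ≤ (∑ S ∈ Finset.univ.powersetCard ℓ, (M S ∪ A S).card) * ℓ.factorial := by
        gcongr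
        exact (Finset.card_le_card hsub).trans Finset.card_biUnion_le
    _ = ∑ S ∈ Finset.univ.powersetCard ℓ, (M S ∪ A S).card * ℓ.factorial :=
        Finset.sum_mul _ _ _
    _ ≤ ∑ S ∈ Finset.univ.powersetCard ℓ, 2 * m.factorial := Finset.sum_le_sum hcard
    _ = 2 * m.choose ℓ * m.factorial := by
        rw [Finset.sum_const, Finset.card_powersetCard, Finset.card_univ, Fintype.card_fin,
          smul_eq_mul]
        ring
end

section
/- Let μ, σ, m, n be natural numbers, let f_1, …, f_m : ℝ → ℝ be continuous functions such that for each i the real line can be partitioned into at most μ + 1 nonempty intervals on each of which f_i is strictly monotone, and such that for all i < j the set {z : f_i(z) = f_j(z)} has at most σ elements. Let V_1 < … < V_n be real numbers. Then the map sending z ∈ ℝ to the pair consisting of the strict-order relation {(i,j) : f_i(z) < f_j(z)} and the predecessor-index function i ↦ #{r : V_r ≤ f_i(z)} takes at most 2·(m·n·(μ+1) + C(m,2)·σ) + 1 distinct values. -/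
open Finset in
theorem finite_and_ncard_range_le_of_eq_on_Icc_disjoint {α : Type*} (P : ℝ → α) (T : Finset ℝ)
    (hP : ∀ x y, x < y → (∀ z ∈ Set.Icc x y, z ∉ T) → P x = P y) :
    (Set.range P).Finite ∧ (Set.range P).ncard ≤ 2 * T.card + 1 := by
  classical
  let g : ℝ → ℕ := fun z => (T.filter (· < z)).card + (T.filter (· ≤ z)).card
  have key : ∀ x y, x < y → g x = g y → P x = P y := by
    intro x y hxy hg
    have h₁ : T.filter (· < x) ⊆ T.filter (· < y) :=
      monotone_filter_right T fun t _ ht => lt_trans ht hxy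
    have h₂ : T.filter (· ≤ x) ⊆ T.filter (· ≤ y) :=
      monotone_filter_right T fun t _ ht => le_trans ht hxy.le
    have c₁ := card_le_card h₁
    have c₂ := card_le_card h₂
    simp only [g] at hg
    have e₁ := eq_of_subset_of_card_le h₁ (by omega)
    have e₂ := eq_of_subset_of_card_le h₂ (by omega)
    refine hP x y hxy fun z hz hzT => ?_
    rcases hz.2.lt_or_eq with h | h
    · have : z ∈ T.filter (· < x) := by rw [e₁]; simp [hzT, h]
      exact absurd hz.1 (not_le.2 (mem_filter.1 this).2)
    · have : z ∈ T.filter (· ≤ x) := by rw [e₂]; exact mem_filter.2 ⟨hzT, h.le⟩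
      have := (mem_filter.1 this).2
      linarith
  have hfac : ∀ x y, g x = g y → P x = P y := by
    intro x y hg
    rcases lt_trichotomy x y with h | h | h
    · exact key x y h hg
    · rw [h]
    · exact (key y x h hg.symm).symm
  have hsub : Set.range P ⊆ ((range (2 * T.card + 1)).image (fun k => P (Function.invFun g k)) :
      Finset α) := by
    rintro _ ⟨z, rfl⟩
    have b₁ := card_filter_le T (· < z)
    have b₂ := card_filter_le T (· ≤ z)
    simp only [coe_image, Set.mem_image, coe_range, Set.mem_Iio]
    refine ⟨g z, by simp only [g]; omega, hfac _ _ (Function.invFun_eq ⟨z, rfl⟩)⟩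
  refine ⟨(finite_toSet _).subset hsub, ?_⟩
  calc _ ≤ _ := Set.ncard_le_ncard hsub (finite_toSet _)
    _ ≤ _ := by
      rw [Set.ncard_coe_finset]
      exact card_image_le.trans (by simp)

theorem lt_iff_lt_of_continuous_of_ne_on_Icc {f g : ℝ → ℝ} (hf : Continuous f) (hg : Continuous g)
    {x y : ℝ} (hxy : x ≤ y) (hne : ∀ z ∈ Set.Icc x y, f z ≠ g z) : f x < g x ↔ f y < g y := by
  have hsub : Continuous fun z => g z - f z := hg.sub hf
  constructor <;> intro h <;> by_contra! h'
  · obtain ⟨z, hz, hz0⟩ := intermediate_value_Icc' hxy hsub.continuousOn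
      (show (0 : ℝ) ∈ Set.Icc _ _ from ⟨by linarith, by linarith⟩)
    exact hne z hz (by simp only at hz0; linarith)
  · obtain ⟨z, hz, hz0⟩ := intermediate_value_Icc hxy hsub.continuousOn
      (show (0 : ℝ) ∈ Set.Icc _ _ from ⟨by linarith, by linarith⟩)
    exact hne z hz (by simp only at hz0; linarith)

theorem finite_and_ncard_le_of_injOn_cover {α β : Type*} {d : ℕ} {f : α → β} {I : Fin d → Set α}
    (hcover : (⋃ t, I t) = Set.univ) (hinj : ∀ t, Set.InjOn f (I t)) (v : β) :
    {z | f z = v}.Finite ∧ {z | f z = v}.ncard ≤ d := by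
  have hex : ∀ z, ∃ t, z ∈ I t := fun z => Set.mem_iUnion.1 (hcover ▸ Set.mem_univ z)
  choose t ht using hex
  have hinj' : Set.InjOn t {z | f z = v} := by
    intro a ha b hb hab
    exact hinj (t a) (ht a) (hab ▸ ht b) (ha.trans hb.symm)
  have hmaps : Set.MapsTo t {z | f z = v} Set.univ := fun _ _ => Set.mem_univ _
  refine ⟨Set.Finite.of_injOn hmaps hinj' Set.finite_univ, ?_⟩
  simpa [Set.ncard_univ] using Set.ncard_le_ncard_of_injOn t hmaps hinj' Set.finite_univ

open Finset in
theorem card_filter_fst_lt_snd_le_choose (m : ℕ) :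
    (univ.filter fun p : Fin m × Fin m => p.1 < p.2).card ≤ m.choose 2 := by
  have h : (powersetCard 2 (univ : Finset (Fin m))).card = m.choose 2 := by simp
  rw [← h]
  refine card_le_card_of_injOn (fun p => {p.1, p.2}) ?_ ?_
  · rintro ⟨a, b⟩ hp
    have hab : a < b := by simpa using hp
    simp [mem_powersetCard, card_pair hab.ne]
  · rintro ⟨a, b⟩ hp ⟨c, d⟩ hq heq
    have hab : a < b := by simpa using hp
    have hcd : c < d := by simpa using hq
    have heq' : ({a, b} : Finset (Fin m)) = {c, d} := heq
    have ha : a ∈ ({c, d} : Finset (Fin m)) := heq' ▸ mem_insert_self a {b}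
    have hb : b ∈ ({c, d} : Finset (Fin m)) := heq' ▸ (by simp)
    have hc : c ∈ ({a, b} : Finset (Fin m)) := heq' ▸ (by simp)
    simp only [mem_insert, mem_singleton] at ha hb hc
    grind

open scoped Classical in
/-- For continuous `f₁,…,f_m`, each piecewise strictly monotone on at most
`μ + 1` nonempty intervals, any two agreeing in at most `σ` points, and thresholds
`V₁ < ⋯ < V_n`, the order/predecessor pattern
`z ↦ ({(i,j) | fᵢ(z) < fⱼ(z)}, i ↦ #{r | V_r ≤ fᵢ(z)})` takes at most
`2·(m·n·(μ+1) + C(m,2)·σ) + 1` distinct values. -/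
theorem stmt11 (μ σ m n : ℕ) (f : Fin m → ℝ → ℝ) (hcont : ∀ i, Continuous (f i))
    (hf : ∀ i, ∃ d ≤ μ + 1, ∃ I : Fin d → Set ℝ,
      (∀ t, (I t).Nonempty) ∧ (∀ t, (I t).OrdConnected) ∧
      Pairwise (Function.onFun Disjoint I) ∧ (⋃ t, I t) = Set.univ ∧
      ∀ t, StrictMonoOn (f i) (I t) ∨ StrictAntiOn (f i) (I t))
    (hpair : ∀ i j : Fin m, i < j →
      {z : ℝ | f i z = f j z}.Finite ∧ {z : ℝ | f i z = f j z}.ncard ≤ σ)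
    (V : Fin n → ℝ) (hV : StrictMono V) :
    (Set.range (fun z : ℝ =>
        (({p : Fin m × Fin m | f p.1 z < f p.2 z} : Set (Fin m × Fin m)),
          fun i : Fin m => (Finset.univ.filter fun r : Fin n => V r ≤ f i z).card))).Finite ∧
    (Set.range (fun z : ℝ =>
        (({p : Fin m × Fin m | f p.1 z < f p.2 z} : Set (Fin m × Fin m)),
          fun i : Fin m => (Finset.univ.filter fun r : Fin n => V r ≤ f i z).card))).ncard ≤
      2 * (m * n * (μ + 1) + m.choose 2 * σ) + 1 := by
  have hlev : ∀ p : Fin m × Fin n, {z | f p.1 z = V p.2}.Finite ∧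
      {z | f p.1 z = V p.2}.ncard ≤ μ + 1 := by
    intro p
    obtain ⟨d, hd, I, -, -, -, hcover, hmono⟩ := hf p.1
    have := finite_and_ncard_le_of_injOn_cover hcover
      (fun t => (hmono t).elim StrictMonoOn.injOn StrictAntiOn.injOn) (V p.2)
    exact ⟨this.1, this.2.trans hd⟩
  let A : Finset ℝ := Finset.univ.biUnion fun p : Fin m × Fin n => (hlev p).1.toFinset
  let B : Finset ℝ := (Finset.univ.filter fun p : Fin m × Fin m => p.1 < p.2).biUnion fun p =>
    if h : p.1 < p.2 then (hpair p.1 p.2 h).1.toFinset else ∅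
  have hA : A.card ≤ m * n * (μ + 1) := by
    refine (Finset.card_biUnion_le_card_mul _ _ (μ + 1) fun p _ => ?_).trans (by simp)
    rw [← Set.ncard_eq_toFinset_card _ (hlev p).1]
    exact (hlev p).2
  have hB : B.card ≤ m.choose 2 * σ := by
    refine (Finset.card_biUnion_le_card_mul _ _ σ fun p hp => ?_).trans
      (Nat.mul_le_mul_right σ (card_filter_fst_lt_snd_le_choose m))
    have hlt : p.1 < p.2 := (Finset.mem_filter.1 hp).2
    rw [dif_pos hlt, ← Set.ncard_eq_toFinset_card _ (hpair p.1 p.2 hlt).1]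
    exact (hpair p.1 p.2 hlt).2
  have hAmem : ∀ i r z, f i z = V r → z ∈ A ∪ B := fun i r z h =>
    Finset.mem_union_left _ (Finset.mem_biUnion.2 ⟨(i, r), Finset.mem_univ _, by simpa using h⟩)
  have hBmem : ∀ i j z, i < j → f i z = f j z → z ∈ A ∪ B := fun i j z hij h =>
    Finset.mem_union_right _ (Finset.mem_biUnion.2 ⟨(i, j), by simpa using hij, by
      simpa [hij] using h⟩)
  have hmain := finite_and_ncard_range_le_of_eq_on_Icc_disjoint
    (fun z : ℝ =>
        (({p : Fin m × Fin m | f p.1 z < f p.2 z} : Set (Fin m × Fin m)),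
          fun i : Fin m => (Finset.univ.filter fun r : Fin n => V r ≤ f i z).card)) (A ∪ B) ?_
  · refine ⟨hmain.1, hmain.2.trans ?_⟩
    have := Finset.card_union_le A B
    omega
  · intro x y hxy hT
    refine Prod.ext ?_ ?_
    · ext ⟨i, j⟩
      change f i x < f j x ↔ f i y < f j y
      rcases eq_or_ne i j with rfl | hij
      · simp
      · refine lt_iff_lt_of_continuous_of_ne_on_Icc (hcont i) (hcont j) hxy.le fun z hz h => ?_
        rcases hij.lt_or_gt with h' | h'
        · exact hT z hz (hBmem i j z h' h)
        · exact hT z hz (hBmem j i z h' h.symm)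
    · funext i
      change (Finset.univ.filter fun r : Fin n => V r ≤ f i x).card =
        (Finset.univ.filter fun r : Fin n => V r ≤ f i y).card
      congr 1
      refine Finset.filter_congr fun r _ => ?_
      rw [← not_lt, ← not_lt, lt_iff_lt_of_continuous_of_ne_on_Icc (hcont i)
        (continuous_const (y := V r)) hxy.le fun z hz h => hT z hz (hAmem i r z h)]
end

section
/- Let T be a positive natural number, p ∈ (0,1], and let X be a random variable with the binomial distribution with T trials and success probability p. Then P(X ≤ T·p/2) ≤ 8/(T·p). -/
open MeasureTheory ProbabilityTheory

/-- The variance of the binomial distribution, as an identity between finite sums. -/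
theorem sum_sq_sub_mul_binomial_weight (T : ℕ) (p : ℝ) :
    ∑ j ∈ Finset.range (T + 1),
      (T * p - j) ^ 2 * ((T.choose j : ℝ) * p ^ j * (1 - p) ^ (T - j)) = T * p * (1 - p) := by
  have h := congrArg (Polynomial.eval p) (bernsteinPolynomial.variance ℝ T)
  simpa [Polynomial.eval_finsetSum, bernsteinPolynomial] using h

/-- Chebyshev's inequality for the lower tail of the binomial weights. -/
theorem sum_binomial_weight_le_half_mean_le (T : ℕ) (hT : 0 < T) (p : ℝ) (hp0 : 0 < p)
    (hp1 : p ≤ 1) :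
    ∑ j ∈ Finset.range (T + 1) with ((j : ℕ) : ℝ) ≤ T * p / 2,
      (T.choose j : ℝ) * p ^ j * (1 - p) ^ (T - j) ≤ 4 * (1 - p) / (T * p) := by
  have hTp : 0 < (T : ℝ) * p := by positivity
  have hq : 0 ≤ 1 - p := sub_nonneg.mpr hp1
  calc
    _ ≤ ∑ j ∈ Finset.range (T + 1) with ((j : ℕ) : ℝ) ≤ T * p / 2,
        4 / (T * p) ^ 2 * ((T * p - j) ^ 2 * ((T.choose j : ℝ) * p ^ j * (1 - p) ^ (T - j))) := by
      refine Finset.sum_le_sum fun j hj => ?_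
      have hj' : (j : ℝ) ≤ T * p / 2 := (Finset.mem_filter.mp hj).2
      rw [← mul_assoc]
      refine le_mul_of_one_le_left (by positivity) ?_
      rw [div_mul_eq_mul_div, one_le_div (by positivity)]
      nlinarith
    _ ≤ ∑ j ∈ Finset.range (T + 1),
        4 / (T * p) ^ 2 * ((T * p - j) ^ 2 * ((T.choose j : ℝ) * p ^ j * (1 - p) ^ (T - j))) :=
      Finset.sum_le_sum_of_subset_of_nonneg (Finset.filter_subset _ _)
        fun j _ _ => by positivity
    _ = 4 * (1 - p) / (T * p) := by
      rw [← Finset.mul_sum, sum_sq_sub_mul_binomial_weight]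
      field_simp

/-- If `X` has the binomial distribution with `T ≥ 1` trials and success
probability `p ∈ (0,1]`, then `P(X ≤ T·p/2) ≤ 8/(T·p)`. -/
theorem stmt15 {Ω : Type*} [MeasureSpace Ω] [IsProbabilityMeasure (ℙ : Measure Ω)]
    (T : ℕ) (hT : 0 < T) (p : ℝ) (hp0 : 0 < p) (hp1 : p ≤ 1)
    (X : Ω → ℕ) (hX : Measurable X)
    (hlaw : ∀ j : ℕ, ℙ {ω | X ω = j} =
      ENNReal.ofReal ((T.choose j : ℝ) * p ^ j * (1 - p) ^ (T - j))) :
    ℙ {ω | (X ω : ℝ) ≤ T * p / 2} ≤ ENNReal.ofReal (8 / (T * p)) := by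
  have hT' : (0 : ℝ) < T := by exact_mod_cast hT
  have hq : 0 ≤ 1 - p := sub_nonneg.mpr hp1
  let s : Finset ℕ := {j ∈ Finset.range (T + 1) | ((j : ℕ) : ℝ) ≤ T * p / 2}
  have hsub : {ω | (X ω : ℝ) ≤ T * p / 2} ⊆ ⋃ j ∈ s, {ω | X ω = j} := by
    intro ω hω
    have hω' : (X ω : ℝ) ≤ T * p / 2 := hω
    have hXT : X ω ≤ T := by
      have : (X ω : ℝ) ≤ T := by nlinarith
      exact_mod_cast this
    simpa [s] using And.intro hXT hω'
  calc
    _ ≤ ∑ j ∈ s, ℙ {ω | X ω = j} :=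
      (measure_mono hsub).trans (measure_biUnion_finset_le _ _)
    _ = ENNReal.ofReal (∑ j ∈ s, (T.choose j : ℝ) * p ^ j * (1 - p) ^ (T - j)) := by
      rw [ENNReal.ofReal_sum_of_nonneg fun j _ => by positivity]
      exact Finset.sum_congr rfl fun j _ => hlaw j
    _ ≤ ENNReal.ofReal (8 / (T * p)) := by
      refine ENNReal.ofReal_le_ofReal
        ((sum_binomial_weight_le_half_mean_le T hT p hp0 hp1).trans ?_)
      gcongr
      linarith
end

section
/- Let W and T be positive natural numbers with T ≥ 2, and let p_1, …, p_W be strictly positive real numbers with p_1 + … + p_W = 1. For each i let χ_i be a random variable with the binomial distribution with T trials and success probability p_i. Then Σ_{i=1}^{W} p_i · E[ log₂(T/χ_i) · 1_{χ_i ≥ 1} ] ≤ Σ_{i=1}^{W} p_i·log₂(2/p_i) + (8·W·log₂ T)/T, where 1_{χ_i ≥ 1} denotes the indicator of the event χ_i ≥ 1. In particular the left-hand side is at most H(p) + 1 + (8·W·log₂ T)/T, where H(p) = Σ_i p_i·log₂(1/p_i). -/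
open MeasureTheory ProbabilityTheory

/-- The mean of `1 / (χ + 1)` for a binomial variable `χ`, scaled by `(T + 1) * p`, is at most `1`. -/
theorem sum_binomial_div_succ_le (T : ℕ) {p : ℝ} (hp : p ≤ 1) :
    (T + 1) * p * ∑ j ∈ Finset.range (T + 1),
      ((T.choose j : ℝ) * p ^ j * (1 - p) ^ (T - j)) * (1 / ((j : ℝ) + 1)) ≤ 1 := by
  have h := add_pow p (1 - p) (T + 1)
  rw [add_sub_cancel, one_pow, Finset.sum_range_succ'] at h
  have hq : 0 ≤ p ^ 0 * (1 - p) ^ (T + 1 - 0) * ((T + 1).choose 0 : ℝ) := by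
    have := sub_nonneg.2 hp
    positivity
  refine le_trans (le_of_eq ?_) ((le_add_of_nonneg_right hq).trans_eq h.symm)
  rw [Finset.mul_sum]
  refine Finset.sum_congr rfl fun j _ => ?_
  have hc : ((T : ℝ) + 1) * T.choose j = (T + 1).choose (j + 1) * (j + 1) := by
    exact_mod_cast Nat.add_one_mul_choose_eq T j
  have hj : (j : ℝ) + 1 ≠ 0 := by positivity
  rw [Nat.add_sub_add_right]
  field_simp
  linear_combination p ^ (j + 1) * (1 - p) ^ (T - j) * hc

theorem integral_one_div_succ_binomial_le {Ω : Type*} [MeasurableSpace Ω] {μ : Measure Ω}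
    [IsProbabilityMeasure μ] (T : ℕ) {p : ℝ} (hp0 : 0 ≤ p) (hp : p ≤ 1) {χ : Ω → ℕ}
    (hχ : Measurable χ) (hlaw : ∀ j : ℕ, μ {ω | χ ω = j} =
      ENNReal.ofReal ((T.choose j : ℝ) * p ^ j * (1 - p) ^ (T - j))) :
    Integrable (fun ω => 1 / ((χ ω : ℝ) + 1)) μ ∧
      (T + 1) * p * ∫ ω, 1 / ((χ ω : ℝ) + 1) ∂μ ≤ 1 := by
  have hbound (n : ℕ) : ‖1 / ((n : ℝ) + 1)‖ ≤ 1 := by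
    rw [Real.norm_of_nonneg (by positivity), div_le_one (by positivity)]
    linarith [n.cast_nonneg (α := ℝ)]
  have := Measure.isProbabilityMeasure_map (μ := μ) hχ.aemeasurable
  have hint : Integrable (fun n : ℕ => 1 / ((n : ℝ) + 1)) (μ.map χ) :=
    Integrable.of_bound Measurable.of_discrete.aestronglyMeasurable 1 (.of_forall hbound)
  refine ⟨hint.comp_measurable hχ, ?_⟩
  have hreal (j : ℕ) : (μ.map χ).real {j} = (T.choose j : ℝ) * p ^ j * (1 - p) ^ (T - j) := by
    have hq := sub_nonneg.2 hp
    rw [measureReal_def, Measure.map_apply hχ (measurableSet_singleton j)]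
    exact (congrArg ENNReal.toReal (hlaw j)).trans (ENNReal.toReal_ofReal (by positivity))
  rw [← integral_map (f := fun n : ℕ => 1 / ((n : ℝ) + 1)) hχ.aemeasurable
    hint.aestronglyMeasurable, integral_countable hint]
  simp only [hreal, smul_eq_mul]
  rw [tsum_eq_sum (s := Finset.range (T + 1))]
  · exact sum_binomial_div_succ_le T hp
  · intro j hj
    rw [Nat.choose_eq_zero_of_lt (by simpa [Nat.lt_succ_iff] using hj)]
    simp

theorem indicator_logb_div_le {T : ℕ} (hT : 1 ≤ T) {p : ℝ} (hp : 0 < p) (n : ℕ) :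
    (if 1 ≤ n then Real.logb 2 ((T : ℝ) / n) else 0) ≤
      Real.logb 2 (2 / p) + (T * p * (1 / ((n : ℝ) + 1)) - 1) / Real.log 2 := by
  have hT' : (1 : ℝ) ≤ T := by exact_mod_cast hT
  have hlog : 0 < Real.log 2 := Real.log_pos one_lt_two
  have hsucc : Real.logb 2 (2 * T / (n + 1)) ≤
      Real.logb 2 (2 / p) + (T * p * (1 / ((n : ℝ) + 1)) - 1) / Real.log 2 := by
    have hx : 0 < T * p * (1 / ((n : ℝ) + 1)) := by positivity
    have heq : 2 * (T : ℝ) / (n + 1) = 2 / p * (T * p * (1 / ((n : ℝ) + 1))) := by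
      field_simp
    rw [heq, Real.logb_mul (by positivity) hx.ne']
    gcongr
    exact div_le_div_of_nonneg_right (Real.log_le_sub_one_of_pos hx) hlog.le
  refine le_trans ?_ hsucc
  split_ifs with hn
  · have hn' : (1 : ℝ) ≤ n := by exact_mod_cast hn
    refine Real.logb_le_logb_of_le one_lt_two (by positivity) ?_
    rw [div_le_div_iff₀ (by positivity) (by positivity)]
    nlinarith
  · obtain rfl : n = 0 := by omega
    refine Real.logb_nonneg one_lt_two ?_
    norm_num
    linarith

theorem integral_indicator_logb_binomial_le {Ω : Type*} [MeasurableSpace Ω] {μ : Measure Ω}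
    [IsProbabilityMeasure μ] {T : ℕ} (hT : 1 ≤ T) {p : ℝ} (hp0 : 0 < p) (hp : p ≤ 1) {χ : Ω → ℕ}
    (hχ : Measurable χ) (hlaw : ∀ j : ℕ, μ {ω | χ ω = j} =
      ENNReal.ofReal ((T.choose j : ℝ) * p ^ j * (1 - p) ^ (T - j))) :
    ∫ ω, Set.indicator {ω' | 1 ≤ χ ω'}
      (fun ω' => Real.logb 2 ((T : ℝ) / (χ ω' : ℝ))) ω ∂μ ≤ Real.logb 2 (2 / p) := by
  by_cases hf : Integrable (Set.indicator {ω' | 1 ≤ χ ω'}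
      (fun ω' => Real.logb 2 ((T : ℝ) / (χ ω' : ℝ)))) μ
  · obtain ⟨hint, hle⟩ := integral_one_div_succ_binomial_le T hp0.le hp hχ hlaw
    have hlin : Integrable
        (fun ω => (T * p * (1 / ((χ ω : ℝ) + 1)) - 1) / Real.log 2) μ :=
      ((hint.const_mul (T * p)).sub (integrable_const 1)).div_const (Real.log 2)
    have hmono := integral_mono hf ((integrable_const (Real.logb 2 (2 / p))).add hlin) fun ω => by
      simpa [Set.indicator_apply] using indicator_logb_div_le hT hp0 (χ ω)
    refine hmono.trans ?_
    simp only [Pi.add_apply]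
    rw [integral_add (integrable_const _) hlin, integral_div,
      integral_sub (hint.const_mul (T * p)) (integrable_const 1), integral_const_mul]
    simp only [integral_const, probReal_univ, one_smul]
    have hnonneg : 0 ≤ ∫ ω, 1 / ((χ ω : ℝ) + 1) ∂μ := integral_nonneg fun ω => by positivity
    have hnum : T * p * ∫ ω, 1 / ((χ ω : ℝ) + 1) ∂μ - 1 ≤ 0 := by
      nlinarith [mul_nonneg hp0.le hnonneg]
    linarith [div_nonpos_of_nonpos_of_nonneg hnum (Real.log_nonneg one_le_two)]
  · rw [integral_undef hf]
    refine Real.logb_nonneg one_lt_two ?_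
    rw [le_div_iff₀ hp0]
    linarith

/-- For strictly positive `p₁,…,p_W` summing to `1`, `T ≥ 2`, and random
variables `χᵢ ~ Binomial(T, pᵢ)`, one has
`Σᵢ pᵢ·E[log₂(T/χᵢ)·1_{χᵢ ≥ 1}] ≤ Σᵢ pᵢ·log₂(2/pᵢ) + 8·W·log₂(T)/T`, and in particular the
left-hand side is at most `H(p) + 1 + 8·W·log₂(T)/T` where `H(p) = Σᵢ pᵢ·log₂(1/pᵢ)`. -/
theorem stmt16 {Ω : Type*} [MeasureSpace Ω] [IsProbabilityMeasure (ℙ : Measure Ω)]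
    (W T : ℕ) (hW : 0 < W) (hT : 2 ≤ T)
    (p : Fin W → ℝ) (hp : ∀ i, 0 < p i) (hsum : ∑ i, p i = 1)
    (χ : Fin W → Ω → ℕ) (hmeas : ∀ i, Measurable (χ i))
    (hlaw : ∀ i, ∀ j : ℕ, ℙ {ω | χ i ω = j} =
      ENNReal.ofReal ((T.choose j : ℝ) * p i ^ j * (1 - p i) ^ (T - j))) :
    (∑ i, p i *
        ∫ ω, Set.indicator {ω' | 1 ≤ χ i ω'}
          (fun ω' => Real.logb 2 ((T : ℝ) / (χ i ω' : ℝ))) ω ∂ℙ) ≤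
      ∑ i, p i * Real.logb 2 (2 / p i) + 8 * W * Real.logb 2 T / T ∧
    (∑ i, p i *
        ∫ ω, Set.indicator {ω' | 1 ≤ χ i ω'}
          (fun ω' => Real.logb 2 ((T : ℝ) / (χ i ω' : ℝ))) ω ∂ℙ) ≤
      (∑ i, p i * Real.logb 2 (1 / p i)) + 1 + 8 * W * Real.logb 2 T / T := by
  have hp1 (i : Fin W) : p i ≤ 1 :=
    hsum ▸ Finset.single_le_sum (fun j _ => (hp j).le) (Finset.mem_univ i)
  have herr : 0 ≤ 8 * W * Real.logb 2 T / T := by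
    have : 0 ≤ Real.logb 2 T :=
      Real.logb_nonneg one_lt_two (by exact_mod_cast one_le_two.trans hT)
    positivity
  have hmain := Finset.sum_le_sum fun i (_ : i ∈ Finset.univ) =>
    mul_le_mul_of_nonneg_left (integral_indicator_logb_binomial_le (one_le_two.trans hT) (hp i)
      (hp1 i) (hmeas i) (hlaw i)) (hp i).le
  have hentropy : ∑ i, p i * Real.logb 2 (2 / p i) =
      (∑ i, p i * Real.logb 2 (1 / p i)) + 1 := by
    have hterm (i : Fin W) :
        p i * Real.logb 2 (2 / p i) = p i * Real.logb 2 (1 / p i) + p i := by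
      have hpi := (hp i).ne'
      rw [Real.logb_div two_ne_zero hpi, Real.logb_div one_ne_zero hpi, Real.logb_one,
        Real.logb_self_eq_one one_lt_two]
      ring
    simp only [hterm, Finset.sum_add_distrib, hsum]
  constructor <;> linarith
end
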